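/- If, for every player i ∈ I, the feasible set X'_i of P_i^CPP (a subset of ℝ^{n_i} × S_{n_i} defined by the linear constraints and the completely positive cone constraint) is nonempty, convex and compact, then the completely positive game G^CPP has at least one pure-strategy Nash equilibrium; this holds because each payoff F_i(x_i, X_i, x_{-i}) is jointly continuous and affine (hence convex) in the player's own variables (x_i, X_i) for each fixed x_{-i}. -/

import Mathlib

open Matrix BigOperators Finset

/-- The completely positive cone: `M = A * Aᵀ` for some entrywise nonnegative matrix `A`. -/
def IsCP {ι : Type*} [Fintype ι] (M : Matrix ι ι ℝ) : Prop :=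
  ∃ (r : ℕ) (A : Matrix ι (Fin r) ℝ), (∀ i j, 0 ≤ A i j) ∧ M = A * Aᵀ

variable {I : Type*} [Fintype I] [DecidableEq I] {n : I → ℕ} {m : I → ℕ}

/-- Concatenation of a strategy profile into one long vector. -/
def conc (s : (i : I) → Fin (n i) → ℝ) : ((i : I) × Fin (n i)) → ℝ := fun p => s p.1 p.2

/-- Feasibility for player `i`'s problem `P_i^MBQP` (the constraints do not involve
the other players). -/
def MBQPFeas (a : (i : I) → Fin (m i) → Fin (n i) → ℝ) (b : (i : I) → Fin (m i) → ℝ)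
    (B : (i : I) → Set (Fin (n i))) (i : I) (y : Fin (n i) → ℝ) : Prop :=
  (∀ j, a i j ⬝ᵥ y = b i j) ∧ (∀ k ∈ B i, y k = 0 ∨ y k = 1) ∧ (∀ k, 0 ≤ y k)

/-- Player `i`'s payoff `f_i(x) = xᵀQ^{(i)}x + 2c^{(i)ᵀ}x` on the full profile. -/
def payoff (Q : (i : I) → Matrix ((i : I) × Fin (n i)) ((i : I) × Fin (n i)) ℝ)
    (c : (i : I) → ((i : I) × Fin (n i)) → ℝ) (i : I)
    (s : (i : I) → Fin (n i) → ℝ) : ℝ :=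
  conc s ⬝ᵥ (Q i *ᵥ conc s) + 2 * (c i ⬝ᵥ conc s)

/-- Pure-strategy Nash equilibrium of the mixed-binary quadratic game `G^MBQP`. -/
def MBQP_PNE (a : (i : I) → Fin (m i) → Fin (n i) → ℝ) (b : (i : I) → Fin (m i) → ℝ)
    (B : (i : I) → Set (Fin (n i)))
    (Q : (i : I) → Matrix ((i : I) × Fin (n i)) ((i : I) × Fin (n i)) ℝ)
    (c : (i : I) → ((i : I) × Fin (n i)) → ℝ)
    (s : (i : I) → Fin (n i) → ℝ) : Prop :=
  ∀ i : I, MBQPFeas a b B i (s i) ∧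
    ∀ y : Fin (n i) → ℝ, MBQPFeas a b B i y →
      payoff Q c i s ≤ payoff Q c i (Function.update s i y)

/-- Feasibility for player `i`'s problem `P_i^CPP` in the completely positive game. -/
def CPPFeas (a : (i : I) → Fin (m i) → Fin (n i) → ℝ) (b : (i : I) → Fin (m i) → ℝ)
    (B : (i : I) → Set (Fin (n i))) (α : (i : I) → Fin (n i) → ℝ) (i : I)
    (y : Fin (n i) → ℝ) (Y : Matrix (Fin (n i)) (Fin (n i)) ℝ) : Prop :=
  (∀ j, a i j ⬝ᵥ y = b i j) ∧
  (∀ j, a i j ⬝ᵥ (Y *ᵥ a i j) = (b i j) ^ 2) ∧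
  (∀ k ∈ B i, y k = Y k k) ∧
  (∀ l, y l = Matrix.trace (((1 / 2 : ℝ) •
    (Matrix.vecMulVec (α i) (Pi.single l 1) + Matrix.vecMulVec (Pi.single l 1) (α i))) * Y)) ∧
  IsCP Y

/-- Player `i`'s payoff `F_i(x_i, X_i, x_{-i})` in the completely positive game:
`Tr(Q^{(i)}_{ii}X_i) + 2x_{-i}ᵀQ^{(i)}_{-i,i}x_i + x_{-i}ᵀQ^{(i)}_{-i,-i}x_{-i} + 2c^{(i)ᵀ}x`. -/
def Fpay (Q : (i : I) → Matrix ((i : I) × Fin (n i)) ((i : I) × Fin (n i)) ℝ)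
    (c : (i : I) → ((i : I) × Fin (n i)) → ℝ) (i : I)
    (s : (i : I) → Fin (n i) → ℝ) (Y : Matrix (Fin (n i)) (Fin (n i)) ℝ) : ℝ :=
  Matrix.trace ((Matrix.of fun k l => Q i ⟨i, k⟩ ⟨i, l⟩) * Y)
  + 2 * (∑ p : (i : I) × Fin (n i), ∑ k : Fin (n i),
      if p.1 ≠ i then Q i p ⟨i, k⟩ * conc s p * s i k else 0)
  + (∑ p : (i : I) × Fin (n i), ∑ q : (i : I) × Fin (n i),
      if p.1 ≠ i ∧ q.1 ≠ i then Q i p q * conc s p * conc s q else 0)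
  + 2 * (c i ⬝ᵥ conc s)

/-- Pure-strategy Nash equilibrium of the completely positive game `G^CPP`. -/
def CPP_PNE (a : (i : I) → Fin (m i) → Fin (n i) → ℝ) (b : (i : I) → Fin (m i) → ℝ)
    (B : (i : I) → Set (Fin (n i))) (α : (i : I) → Fin (n i) → ℝ)
    (Q : (i : I) → Matrix ((i : I) × Fin (n i)) ((i : I) × Fin (n i)) ℝ)
    (c : (i : I) → ((i : I) × Fin (n i)) → ℝ)
    (s : (i : I) → Fin (n i) → ℝ)
    (XX : (i : I) → Matrix (Fin (n i)) (Fin (n i)) ℝ) : Prop :=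
  ∀ i : I, CPPFeas a b B α i (s i) (XX i) ∧
    ∀ (y : Fin (n i) → ℝ) (Y : Matrix (Fin (n i)) (Fin (n i)) ℝ),
      CPPFeas a b B α i y Y →
        Fpay Q c i s (XX i) ≤ Fpay Q c i (Function.update s i y) Y

/-- The Key Property (KP) for player `i`, with witness `α i = Σ_j y_j a_j^{(i)}`. -/
def KeyProperty (a : (i : I) → Fin (m i) → Fin (n i) → ℝ) (b : (i : I) → Fin (m i) → ℝ)
    (α : (i : I) → Fin (n i) → ℝ) : Prop :=
  ∀ i : I, ∃ y : Fin (m i) → ℝ,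
    (α i = ∑ j, y j • a i j) ∧ (∀ k, 0 ≤ α i k) ∧ (∑ j, y j * b i j) = 1

open MeasureTheory Metric in
/-- If `f t x` is polynomial in `t` of bounded degree and `∫ f t` is constant for `t` in an
interval `(0, ε)`, then it is constant. -/
lemma integral_eq_of_polynomial_of_eq_on_Ioo {X : Type*} [MeasurableSpace X] {μ : Measure X}
    {f : ℝ → X → ℝ} (N : ℕ)
    (hpoly : ∀ x, ∃ p : Polynomial ℝ, p.natDegree ≤ N ∧ ∀ t, p.eval t = f t x)
    (hint : ∀ t, Integrable (f t) μ) {ε c : ℝ} (hε : 0 < ε)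
    (hc : ∀ t, 0 < t → t < ε → ∫ x, f t x ∂μ = c) (t : ℝ) : ∫ x, f t x ∂μ = c := by
  set v : ℕ → ℝ := fun j => ε / (j + 2) with hv
  set s := Finset.range (N + 1)
  have hv_pos (j : ℕ) : 0 < v j := by positivity
  have hv_lt (j : ℕ) : v j < ε := by
    rw [hv, div_lt_iff₀ (by positivity)]
    nlinarith [(Nat.cast_nonneg j : (0 : ℝ) ≤ j)]
  have hinj : Set.InjOn v s := by
    intro i _ j _ hij
    simp only [hv] at hij
    rw [div_eq_div_iff (by positivity) (by positivity)] at hij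
    have := mul_left_cancel₀ hε.ne' hij
    exact_mod_cast (by linarith : (i : ℝ) = j)
  have hf (x : X) : f t x = ∑ j ∈ s, (Lagrange.basis s v j).eval t * f (v j) x := by
    obtain ⟨p, hp, hpe⟩ := hpoly x
    have hdeg : p.degree < (s.card : WithBot ℕ) := by
      refine Polynomial.degree_le_natDegree.trans_lt ?_
      simp only [s, Finset.card_range]
      exact_mod_cast Nat.lt_succ_of_le hp
    conv_lhs => rw [← hpe, Lagrange.eq_interpolate hinj hdeg, Lagrange.interpolate_apply]
    rw [Polynomial.eval_finsetSum]
    refine Finset.sum_congr rfl fun j _ => ?_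
    rw [Polynomial.eval_mul, Polynomial.eval_C, hpe, mul_comm]
  simp_rw [hf]
  rw [integral_finsetSum _ fun j _ => (hint (v j)).const_mul _]
  simp_rw [integral_const_mul, fun j => hc (v j) (hv_pos j) (hv_lt j)]
  rw [← Finset.sum_mul, ← Polynomial.eval_finsetSum, Lagrange.sum_basis hinj ⟨0, by simp [s]⟩]
  simp

/-- The determinant of `1 - t • A` is a polynomial in `t` of degree at most the dimension. -/
lemma exists_polynomial_det_one_sub_smul {E : Type*} [NormedAddCommGroup E] [NormedSpace ℝ E]
    [FiniteDimensional ℝ E] (A : E →L[ℝ] E) :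
    ∃ p : Polynomial ℝ, p.natDegree ≤ Module.finrank ℝ E ∧
      ∀ t : ℝ, p.eval t = (1 - t • A : E →L[ℝ] E).det := by
  set b := Module.finBasis ℝ E
  set M := LinearMap.toMatrix b b (A : E →ₗ[ℝ] E) with hM
  refine ⟨((Polynomial.X : Polynomial ℝ) • (-M).map Polynomial.C +
    (1 : Matrix (Fin (Module.finrank ℝ E)) (Fin (Module.finrank ℝ E)) ℝ).map Polynomial.C).det,
    ?_, fun t => ?_⟩
  · simpa using Polynomial.natDegree_det_X_add_C_le (-M) (1 : Matrix (Fin _) (Fin _) ℝ)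
  · have h : (1 - t • A : E →L[ℝ] E).det = LinearMap.det (1 - t • (A : E →ₗ[ℝ] E)) := rfl
    rw [h, ← LinearMap.det_toMatrix b, ← Polynomial.coe_evalRingHom, RingHom.map_det]
    congr 1
    ext i j
    by_cases hij : i = j <;>
      simp [hM, hij, sub_eq_neg_add, LinearMap.toMatrix_one, mul_comm t]

open Metric in
/-- A small perturbation of the identity supported in a ball maps the ball onto itself. -/
lemma image_closedBall_sub_smul {E : Type*} [NormedAddCommGroup E] [NormedSpace ℝ E]
    [CompleteSpace E] {g : E → E} {C : NNReal} (hg : LipschitzWith C g) {R : ℝ}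
    (hsupp : ∀ x ∉ closedBall (0 : E) R, g x = 0) {t : ℝ} (ht0 : 0 ≤ t) (ht : t * C < 1) :
    Function.Injective (fun x => x - t • g x) ∧
      (fun x => x - t • g x) '' closedBall 0 R = closedBall 0 R := by
  have hcontr (y : E) : ContractingWith (t.toNNReal * C) (fun x => y + t • g x) := by
    refine ⟨?_, LipschitzWith.of_dist_le_mul fun u v => ?_⟩
    · rw [← NNReal.coe_lt_coe]
      simpa [Real.coe_toNNReal t ht0] using ht
    · rw [dist_add_left, dist_smul₀, NNReal.coe_mul, Real.coe_toNNReal t ht0, Real.norm_eq_abs,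
        abs_of_nonneg ht0, mul_assoc]
      exact mul_le_mul_of_nonneg_left (hg.dist_le_mul u v) ht0
  have hinj : Function.Injective (fun x => x - t • g x) := by
    intro u v huv
    refine (hcontr (v - t • g v)).fixedPoint_unique' (x := u) (y := v) ?_ ?_
    · change v - t • g v + t • g u = u
      rw [← show u - t • g u = v - t • g v from huv]
      abel
    · change v - t • g v + t • g v = v
      abel
  have hout (x : E) (hx : x ∉ closedBall (0 : E) R) : x - t • g x = x := by
    rw [hsupp x hx, smul_zero, sub_zero]
  refine ⟨hinj, Set.Subset.antisymm ?_ fun y hy => ?_⟩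
  · rintro _ ⟨x, hx, rfl⟩
    by_contra h
    exact h (by simpa only [hinj (hout _ h)] using hx)
  · have hfix := (hcontr y).fixedPoint_isFixedPt
    set x := ContractingWith.fixedPoint _ (hcontr y)
    have hxy : x - t • g x = y := by
      rw [sub_eq_iff_eq_add]
      exact hfix.symm
    refine ⟨x, ?_, hxy⟩
    by_contra h
    exact h (by rwa [← hout x h, hxy])

open MeasureTheory Metric in
/-- The change of variables formula for `x ↦ x - g x`, with `g` supported in a ball, applied to
the powers of `y ↦ M ^ 2 - ‖y‖ ^ 2`. -/
lemma integral_pow_mul_det_one_sub_fderiv {E : Type*} [NormedAddCommGroup E]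
    [InnerProductSpace ℝ E] [FiniteDimensional ℝ E] [MeasurableSpace E] [BorelSpace E]
    (μ : Measure E) [μ.IsAddHaarMeasure] {g : E → E} (hg : ContDiff ℝ 1 g)
    (hcomp : HasCompactSupport g) {R : ℝ} (hsupp : ∀ x ∉ closedBall (0 : E) R, g x = 0)
    (M : ℝ) (k : ℕ) :
    ∫ x in closedBall (0 : E) R, (M ^ 2 - ‖x - g x‖ ^ 2) ^ k * (1 - fderiv ℝ g x).det ∂μ =
      ∫ x in closedBall (0 : E) R, (M ^ 2 - ‖x‖ ^ 2) ^ k ∂μ := by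
  have hgc := hg.continuous
  have hg'c : Continuous (fderiv ℝ g) := hg.continuous_fderiv one_ne_zero
  obtain ⟨C, hC⟩ := hg.lipschitzWith_of_hasCompactSupport hcomp one_ne_zero
  obtain ⟨C', hC'⟩ := (hcomp.fderiv ℝ).exists_bound_of_continuous hg'c
  obtain ⟨δ, hδ, hdet⟩ : ∃ δ > 0, ∀ A : E →L[ℝ] E, dist A 1 < δ → 0 < A.det := by
    have h : ∀ᶠ A : E →L[ℝ] E in nhds 1, 0 < A.det := by
      refine ContinuousLinearMap.continuous_det.continuousAt.eventually_const_lt ?_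
      have : (1 : E →L[ℝ] E).det = 1 := LinearMap.det_id
      simp only [this, one_pos]
    exact Metric.eventually_nhds_iff.1 h
  set D : ℝ := max (C : ℝ) C' + 1
  have hD : 0 < D := by
    have : (0 : ℝ) ≤ max (C : ℝ) C' := le_max_of_le_left C.2
    positivity
  have key := integral_eq_of_polynomial_of_eq_on_Ioo (μ := μ.restrict (closedBall (0 : E) R))
    (f := fun t x => (M ^ 2 - ‖x - t • g x‖ ^ 2) ^ k * (1 - t • fderiv ℝ g x).det)
    (k * 2 + Module.finrank ℝ E) (ε := min 1 δ / D)
    (c := ∫ x in closedBall (0 : E) R, (M ^ 2 - ‖x‖ ^ 2) ^ k ∂μ) ?_ ?_ (by positivity) ?_ 1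
  · simpa only [one_smul] using key
  · intro x
    obtain ⟨p, hp, hpe⟩ := exists_polynomial_det_one_sub_smul (fderiv ℝ g x)
    refine ⟨(Polynomial.C (M ^ 2 - ‖x‖ ^ 2) + Polynomial.C (2 * inner ℝ x (g x)) * Polynomial.X -
      Polynomial.C (‖g x‖ ^ 2) * Polynomial.X ^ 2) ^ k * p, ?_, fun t => ?_⟩
    · refine Polynomial.natDegree_mul_le.trans (add_le_add ?_ hp)
      refine Polynomial.natDegree_pow_le_of_le k ?_
      compute_degree
    · rw [Polynomial.eval_mul, hpe, Polynomial.eval_pow, norm_sub_sq_real, inner_smul_right,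
        norm_smul, Real.norm_eq_abs, mul_pow, sq_abs]
      congr 2
      simp only [Polynomial.eval_sub, Polynomial.eval_add, Polynomial.eval_mul,
        Polynomial.eval_C, Polynomial.eval_X, Polynomial.eval_pow]
      ring
  · intro t
    refine ContinuousOn.integrableOn_compact (isCompact_closedBall _ _) ?_
    refine Continuous.continuousOn (Continuous.mul (by fun_prop) ?_)
    exact ContinuousLinearMap.continuous_det.comp (by fun_prop)
  · intro t ht0 ht
    rw [lt_div_iff₀ hD] at ht
    have htC : t * C < 1 := by
      have : (C : ℝ) < D := (le_max_left _ _).trans_lt (lt_add_one _)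
      nlinarith [min_le_left 1 δ]
    obtain ⟨hinj, himg⟩ := image_closedBall_sub_smul hC hsupp ht0.le htC
    have hcv := integral_image_eq_integral_abs_det_fderiv_smul μ
      (s := closedBall (0 : E) R) (f := fun x => x - t • g x)
      (f' := fun x => 1 - t • fderiv ℝ g x) measurableSet_closedBall ?_ hinj.injOn
      (fun y => (M ^ 2 - ‖y‖ ^ 2) ^ k)
    · rw [himg] at hcv
      rw [hcv]
      refine integral_congr_ae (Filter.Eventually.of_forall fun x => ?_)
      have hpos : 0 < (1 - t • fderiv ℝ g x).det := by
        refine hdet _ ?_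
        rw [dist_eq_norm, sub_sub_cancel_left, norm_neg, norm_smul, Real.norm_eq_abs,
          abs_of_pos ht0]
        have : ‖fderiv ℝ g x‖ < D := ((hC' x).trans (le_max_right _ _)).trans_lt (lt_add_one _)
        nlinarith [min_le_right 1 δ]
      simp only [abs_of_pos hpos, smul_eq_mul]
      rw [mul_comm]
    · intro x _
      have h := ((hg.differentiable one_ne_zero) x).hasFDerivAt
      exact ((hasFDerivAt_id x).sub (h.const_smul t)).hasFDerivWithinAt

open MeasureTheory Metric in
/-- A compactly supported `C¹` self-map of a finite-dimensional Euclidean space has a fixed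
point. -/
lemma exists_fixedPoint_of_contDiff_of_hasCompactSupport {E : Type*} [NormedAddCommGroup E]
    [InnerProductSpace ℝ E] [FiniteDimensional ℝ E] {g : E → E} (hg : ContDiff ℝ 1 g)
    (hcomp : HasCompactSupport g) : ∃ x, g x = x := by
  let : MeasurableSpace E := borel E
  have : BorelSpace E := ⟨rfl⟩
  let μ : Measure E := volume
  by_contra! hne
  have hgc := hg.continuous
  have hg'c : Continuous (fderiv ℝ g) := hg.continuous_fderiv one_ne_zero
  obtain ⟨R, hR, hsupp⟩ : ∃ R > 0, ∀ x ∉ closedBall (0 : E) R, g x = 0 := by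
    obtain ⟨R, hR, h⟩ := hcomp.isBounded.subset_closedBall_lt 0 0
    exact ⟨R, hR, fun x hx => image_eq_zero_of_notMem_tsupport fun hx' => hx (h hx')⟩
  have hK : IsCompact (closedBall (0 : E) R) := isCompact_closedBall _ _
  have hKne : (closedBall (0 : E) R).Nonempty := nonempty_closedBall.2 hR.le
  have hFc : Continuous fun x => ‖x - g x‖ := by fun_prop
  obtain ⟨x₀, hx₀, hmin⟩ := hK.exists_isMinOn hKne hFc.continuousOn
  obtain ⟨x₁, hx₁, hmax⟩ := hK.exists_isMaxOn hKne hFc.continuousOn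
  obtain ⟨C, hC⟩ := hK.exists_bound_of_continuousOn
    (f := fun x => (1 - fderiv ℝ g x).det)
    (ContinuousLinearMap.continuous_det.comp (by fun_prop)).continuousOn
  set d := min ‖x₀ - g x₀‖ R with hd_def
  have hd : 0 < d := lt_min (norm_pos_iff.2 (sub_ne_zero.2 (hne x₀).symm)) hR
  have hdF (x : E) (hx : x ∈ closedBall (0 : E) R) : d ≤ ‖x - g x‖ :=
    (min_le_left _ _).trans (hmin hx)
  set M := max ‖x₁ - g x₁‖ R with hM_def
  have hMF (x : E) (hx : x ∈ closedBall (0 : E) R) : ‖x - g x‖ ≤ M :=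
    (hmax hx).trans (le_max_left _ _)
  have hRM : R ≤ M := le_max_right _ _
  have hdR : d ≤ R := min_le_right _ _
  set p := M ^ 2 - d ^ 2
  set q := M ^ 2 - (d / 2) ^ 2
  have hp : 0 ≤ p := by simp only [p]; nlinarith
  have hpq : p < q := by simp only [p, q]; nlinarith
  have hq : 0 < q := hp.trans_lt hpq
  set V := μ.real (closedBall (0 : E) R)
  set v := μ.real (closedBall (0 : E) (d / 2))
  have hv : 0 < v := ENNReal.toReal_pos
    (measure_closedBall_pos μ 0 (by positivity)).ne' measure_closedBall_lt_top.ne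
  have hsub : closedBall (0 : E) (d / 2) ⊆ closedBall 0 R :=
    closedBall_subset_closedBall (by linarith)
  have hbound (k : ℕ) : q ^ k * v ≤ p ^ k * (C * V) := by
    have hup : ‖∫ x in closedBall (0 : E) R,
        (M ^ 2 - ‖x - g x‖ ^ 2) ^ k * (1 - fderiv ℝ g x).det ∂μ‖ ≤ (p ^ k * C) * V := by
      refine norm_setIntegral_le_of_norm_le_const measure_closedBall_lt_top fun x hx => ?_
      rw [norm_mul, norm_pow]
      refine mul_le_mul (pow_le_pow_left₀ (norm_nonneg _) ?_ k) (hC x hx) (norm_nonneg _)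
        (by positivity)
      have h1 := hdF x hx
      have h2 := hMF x hx
      rw [Real.norm_eq_abs, abs_of_nonneg (by nlinarith)]
      simp only [p]
      nlinarith
    have hcont : Continuous fun x : E => (M ^ 2 - ‖x‖ ^ 2) ^ k := by fun_prop
    have hlow : v * q ^ k ≤ ∫ x in closedBall (0 : E) R, (M ^ 2 - ‖x‖ ^ 2) ^ k ∂μ := by
      calc v * q ^ k = ∫ x in closedBall (0 : E) (d / 2), q ^ k ∂μ := by
            rw [setIntegral_const, smul_eq_mul]
        _ ≤ ∫ x in closedBall (0 : E) (d / 2), (M ^ 2 - ‖x‖ ^ 2) ^ k ∂μ := by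
            refine setIntegral_mono_on (integrableOn_const measure_closedBall_lt_top.ne)
              (hcont.continuousOn.integrableOn_compact (isCompact_closedBall _ _))
              measurableSet_closedBall fun x hx => pow_le_pow_left₀ hq.le ?_ k
            rw [mem_closedBall_zero_iff] at hx
            simp only [q]
            nlinarith [norm_nonneg x]
        _ ≤ _ := by
            refine setIntegral_mono_set (hcont.continuousOn.integrableOn_compact hK) ?_
              hsub.eventuallyLE
            refine (ae_restrict_iff' measurableSet_closedBall).2
              (Filter.Eventually.of_forall fun x hx => pow_nonneg ?_ k)
            rw [mem_closedBall_zero_iff] at hx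
            nlinarith [norm_nonneg x]
    rw [integral_pow_mul_det_one_sub_fderiv μ hg hcomp hsupp M k] at hup
    nlinarith [le_abs_self (∫ x in closedBall (0 : E) R, (M ^ 2 - ‖x‖ ^ 2) ^ k ∂μ),
      Real.norm_eq_abs (∫ x in closedBall (0 : E) R, (M ^ 2 - ‖x‖ ^ 2) ^ k ∂μ)]
  have hlim : Filter.Tendsto (fun k : ℕ => (p / q) ^ k * (C * V)) Filter.atTop (nhds 0) := by
    simpa using (tendsto_pow_atTop_nhds_zero_of_lt_one (by positivity)
      ((div_lt_one hq).2 hpq)).mul_const (C * V)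
  refine hv.not_ge (ge_of_tendsto' hlim fun k => ?_)
  rw [div_pow, div_mul_eq_mul_div, le_div_iff₀ (by positivity), mul_comm]
  exact hbound k

open Metric in
/-- **Brouwer's fixed point theorem** for continuous bounded self-maps of a finite-dimensional
Euclidean space. -/
theorem exists_fixedPoint_of_continuous_of_bounded {E : Type*} [NormedAddCommGroup E]
    [InnerProductSpace ℝ E] [FiniteDimensional ℝ E] {f : E → E} (hf : Continuous f) {R : ℝ}
    (hR : ∀ x, ‖f x‖ ≤ R) : ∃ x, f x = x := by
  by_contra! hne
  have hR0 : 0 ≤ R := (norm_nonneg _).trans (hR 0)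
  have hFc : Continuous fun x => ‖x - f x‖ := by fun_prop
  obtain ⟨x₀, -, hmin⟩ := (isCompact_closedBall (0 : E) (R + 1)).exists_isMinOn
    (nonempty_closedBall.2 (by positivity)) hFc.continuousOn
  have hd : 0 < ‖x₀ - f x₀‖ := norm_pos_iff.2 (sub_ne_zero.2 (hne x₀).symm)
  obtain ⟨h, hh, hdist, -⟩ := hf.exists_contDiff_approx (1 : ℕ∞)
    (ε := fun _ => min 1 ‖x₀ - f x₀‖) continuous_const fun _ => lt_min one_pos hd
  let χ : ContDiffBump (0 : E) := ⟨R + 1, R + 2, by positivity, by linarith⟩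
  obtain ⟨x, hx⟩ := exists_fixedPoint_of_contDiff_of_hasCompactSupport
    (g := fun x => χ x • h x) (χ.contDiff.smul (mod_cast hh)) χ.hasCompactSupport.smul_right
  have hhx : ‖h x‖ ≤ R + 1 := by
    have h1 := (hdist x).trans_le (min_le_left _ _)
    rw [dist_eq_norm] at h1
    linarith [norm_le_norm_add_norm_sub' (h x) (f x), hR x]
  have hxR : x ∈ closedBall (0 : E) (R + 1) := by
    rw [mem_closedBall_zero_iff, ← hx, norm_smul, Real.norm_eq_abs, abs_of_nonneg χ.nonneg]
    exact (mul_le_of_le_one_left (norm_nonneg _) χ.le_one).trans hhx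
  simp only [χ.one_of_mem_closedBall hxR, one_smul] at hx
  have h2 := (hdist x).trans_le (min_le_right _ _)
  rw [dist_eq_norm, hx] at h2
  exact h2.not_ge (hmin hxR)

/-- The metric projection onto a nonempty closed convex set is continuous. -/
lemma exists_continuous_projection {E : Type*} [NormedAddCommGroup E] [InnerProductSpace ℝ E]
    {K : Set E} (hne : K.Nonempty) (hcomplete : IsComplete K) (hconv : Convex ℝ K) :
    ∃ P : E → E, Continuous P ∧ (∀ u, P u ∈ K) ∧
      ∀ u, ∀ w ∈ K, inner ℝ (u - P u) (w - P u) ≤ 0 := by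
  choose P hPK hP using exists_norm_eq_iInf_of_complete_convex hne hcomplete hconv
  have hinner (u : E) : ∀ w ∈ K, inner ℝ (u - P u) (w - P u) ≤ 0 :=
    (norm_eq_iInf_iff_real_inner_le_zero hconv (hPK u)).1 (hP u)
  refine ⟨P, LipschitzWith.continuous (K := 1) (LipschitzWith.of_dist_le_mul fun u v => ?_),
    hPK, hinner⟩
  have h1 := hinner u (P v) (hPK v)
  have h2 := hinner v (P u) (hPK u)
  have h3 : ‖P u - P v‖ * ‖P u - P v‖ ≤ ‖u - v‖ * ‖P u - P v‖ := by
    refine le_trans ?_ (real_inner_le_norm (u - v) (P u - P v))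
    rw [← real_inner_self_eq_norm_mul_norm]
    simp only [inner_sub_left, inner_sub_right] at h1 h2 ⊢
    linarith [real_inner_comm (P u) (P v)]
  rw [NNReal.coe_one, one_mul, dist_eq_norm, dist_eq_norm]
  rcases (norm_nonneg (P u - P v)).eq_or_lt with h | h
  · rw [← h]
    exact norm_nonneg _
  · exact le_of_mul_le_mul_right h3 h

/-- **Hartman–Stampacchia**: a continuous variational inequality on a nonempty compact convex
subset of a Euclidean space has a solution. -/
lemma exists_inner_sub_nonneg {E : Type*} [NormedAddCommGroup E] [InnerProductSpace ℝ E]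
    [FiniteDimensional ℝ E] {K : Set E} (hne : K.Nonempty) (hcpt : IsCompact K)
    (hconv : Convex ℝ K) {v : E → E} (hv : Continuous v) :
    ∃ x ∈ K, ∀ w ∈ K, 0 ≤ inner ℝ (v x) (w - x) := by
  obtain ⟨P, hPc, hPK, hP⟩ := exists_continuous_projection hne hcpt.isComplete hconv
  obtain ⟨R, hR⟩ := hcpt.isBounded.exists_norm_le
  obtain ⟨x, hx⟩ := exists_fixedPoint_of_continuous_of_bounded
    (f := fun x => P (x - v x)) (hPc.comp (by fun_prop)) fun x => hR _ (hPK _)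
  refine ⟨x, hx ▸ hPK _, fun w hw => ?_⟩
  have h := hP (x - v x) w hw
  simp only [hx, sub_sub_cancel_left, inner_neg_left] at h
  linarith

/-- A continuous family of linear forms on a finite-dimensional space admits, on every nonempty
compact convex set, a point minimizing its own linear form. -/
lemma exists_forall_linearMap_le {V : Type*} [AddCommGroup V] [TopologicalSpace V]
    [IsTopologicalAddGroup V] [T2Space V] [Module ℝ V] [ContinuousSMul ℝ V]
    [FiniteDimensional ℝ V] {K : Set V} (hne : K.Nonempty) (hcpt : IsCompact K)
    (hconv : Convex ℝ K) {G : V → V →ₗ[ℝ] ℝ} (hG : ∀ y, Continuous fun x => G x y) :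
    ∃ x ∈ K, ∀ y ∈ K, G x x ≤ G x y := by
  let e := toEuclidean (E := V)
  let b := EuclideanSpace.basisFun (Fin (Module.finrank ℝ V)) ℝ
  let v : EuclideanSpace ℝ (Fin (Module.finrank ℝ V)) →
      EuclideanSpace ℝ (Fin (Module.finrank ℝ V)) :=
    fun x => ∑ j, G (e.symm x) (e.symm (b j)) • b j
  have hv : Continuous v := continuous_finsetSum _ fun j _ =>
    ((hG (e.symm (b j))).comp e.symm.continuous).smul continuous_const
  have hinner (x w) : inner ℝ (v x) w = G (e.symm x) (e.symm w) := by
    conv_rhs => rw [← b.sum_repr' w]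
    simp only [v, sum_inner, map_sum, map_smul, real_inner_smul_left, smul_eq_mul]
    exact Finset.sum_congr rfl fun j _ => mul_comm _ _
  obtain ⟨x, ⟨x', hx', rfl⟩, hx⟩ := exists_inner_sub_nonneg (hne.image e)
    (hcpt.image e.continuous) (hconv.linear_image e.toLinearMap) hv
  refine ⟨x', hx', fun y hy => ?_⟩
  have h := hx (e y) ⟨y, hy, rfl⟩
  rw [hinner] at h
  simpa using h

/-- A game with finitely many players, nonempty compact convex strategy sets in finite-dimensional
spaces, and costs that are linear in the player's own strategy and continuous in the profile,
has a pure-strategy Nash equilibrium. -/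
lemma exists_nash_of_linear_costs {ι : Type*} [Finite ι] {W : ι → Type*}
    [∀ i, AddCommGroup (W i)] [∀ i, TopologicalSpace (W i)] [∀ i, IsTopologicalAddGroup (W i)]
    [∀ i, T2Space (W i)] [∀ i, Module ℝ (W i)] [∀ i, ContinuousSMul ℝ (W i)]
    [∀ i, FiniteDimensional ℝ (W i)] {K : ∀ i, Set (W i)} (hne : ∀ i, (K i).Nonempty)
    (hcpt : ∀ i, IsCompact (K i)) (hconv : ∀ i, Convex ℝ (K i))
    {L : ∀ i, (∀ j, W j) → W i →ₗ[ℝ] ℝ} (hL : ∀ i w, Continuous fun z => L i z w) :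
    ∃ z : ∀ i, W i, ∀ i, z i ∈ K i ∧ ∀ w ∈ K i, L i z (z i) ≤ L i z w := by
  classical
  have := Fintype.ofFinite ι
  obtain ⟨z, hz, hmin⟩ := exists_forall_linearMap_le (Set.univ_pi_nonempty_iff.2 hne)
    (isCompact_univ_pi hcpt) (convex_pi fun i _ => hconv i)
    (G := fun z => ∑ i, L i z ∘ₗ LinearMap.proj i) fun y => by
      simp only [LinearMap.sum_apply, LinearMap.comp_apply, LinearMap.proj_apply]
      exact continuous_finsetSum _ fun i _ => hL i (y i)
  refine ⟨z, fun i => ⟨hz i trivial, fun w hw => ?_⟩⟩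
  have hmem : Function.update z i w ∈ Set.univ.pi K := by
    intro j _
    rcases eq_or_ne j i with rfl | hj
    · simpa using hw
    · simpa [hj] using hz j trivial
  have h := hmin _ hmem
  simp only [LinearMap.sum_apply, LinearMap.comp_apply, LinearMap.proj_apply] at h
  rw [← Finset.add_sum_erase _ _ (Finset.mem_univ i),
    ← Finset.add_sum_erase _ (fun j => L j z (Function.update z i w j)) (Finset.mem_univ i),
    Function.update_self] at h
  have hrest : ∑ j ∈ Finset.univ.erase i, L j z (Function.update z i w j) =
      ∑ j ∈ Finset.univ.erase i, L j z (z j) :=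
    Finset.sum_congr rfl fun j hj => by rw [Function.update_of_ne (Finset.ne_of_mem_erase hj)]
  rw [hrest] at h
  exact le_of_add_le_add_right h

/-- The part of player `i`'s payoff in the completely positive game that depends on the player's
own strategy, which is linear in it. -/
noncomputable def ownPayoff
    (Q : (i : I) → Matrix ((i : I) × Fin (n i)) ((i : I) × Fin (n i)) ℝ)
    (c : (i : I) → ((i : I) × Fin (n i)) → ℝ) (i : I) (s : (i : I) → Fin (n i) → ℝ) :
    (Fin (n i) → ℝ) × Matrix (Fin (n i)) (Fin (n i)) ℝ →ₗ[ℝ] ℝ :=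
  Matrix.traceLinearMap _ ℝ ℝ ∘ₗ
      LinearMap.mulLeft ℝ (Matrix.of fun k l => Q i ⟨i, k⟩ ⟨i, l⟩) ∘ₗ LinearMap.snd ℝ _ _ +
    (∑ k : Fin (n i), ((2 * ∑ p : (i : I) × Fin (n i),
      if p.1 ≠ i then Q i p ⟨i, k⟩ * conc s p else 0) + 2 * c i ⟨i, k⟩) • LinearMap.proj k) ∘ₗ
      LinearMap.fst ℝ _ _

/-- The part of player `i`'s payoff in the completely positive game that depends only on the other
players' strategies. -/
noncomputable def othersPayoff
    (Q : (i : I) → Matrix ((i : I) × Fin (n i)) ((i : I) × Fin (n i)) ℝ)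
    (c : (i : I) → ((i : I) × Fin (n i)) → ℝ) (i : I) (s : (i : I) → Fin (n i) → ℝ) : ℝ :=
  (∑ p : (i : I) × Fin (n i), ∑ q : (i : I) × Fin (n i),
      if p.1 ≠ i ∧ q.1 ≠ i then Q i p q * conc s p * conc s q else 0) +
    2 * ∑ p : (i : I) × Fin (n i), if p.1 ≠ i then c i p * conc s p else 0

lemma conc_update_of_ne {ι : Type*} [DecidableEq ι] {d : ι → ℕ} {s : (i : ι) → Fin (d i) → ℝ}
    {i : ι} {y : Fin (d i) → ℝ} {p : (i : ι) × Fin (d i)} (hp : p.1 ≠ i) :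
    conc (Function.update s i y) p = conc s p := by
  simp [conc, hp]

lemma Fpay_update (Q : (i : I) → Matrix ((i : I) × Fin (n i)) ((i : I) × Fin (n i)) ℝ)
    (c : (i : I) → ((i : I) × Fin (n i)) → ℝ) (i : I) (s : (i : I) → Fin (n i) → ℝ)
    (y : Fin (n i) → ℝ) (Y : Matrix (Fin (n i)) (Fin (n i)) ℝ) :
    Fpay Q c i (Function.update s i y) Y = ownPayoff Q c i s (y, Y) + othersPayoff Q c i s := by
  have hcross : (∑ p : (i : I) × Fin (n i), ∑ k : Fin (n i), if p.1 ≠ i then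
        Q i p ⟨i, k⟩ * conc (Function.update s i y) p * Function.update s i y i k else 0) =
      ∑ k : Fin (n i), (∑ p : (i : I) × Fin (n i),
        if p.1 ≠ i then Q i p ⟨i, k⟩ * conc s p else 0) * y k := by
    rw [Finset.sum_comm]
    refine Finset.sum_congr rfl fun k _ => ?_
    rw [Finset.sum_mul]
    refine Finset.sum_congr rfl fun p _ => ?_
    split_ifs with hp
    · rw [conc_update_of_ne hp, Function.update_self]
    · rw [zero_mul]
  have hothers : (∑ p : (i : I) × Fin (n i), ∑ q : (i : I) × Fin (n i), if p.1 ≠ i ∧ q.1 ≠ i then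
        Q i p q * conc (Function.update s i y) p * conc (Function.update s i y) q else 0) =
      ∑ p : (i : I) × Fin (n i), ∑ q : (i : I) × Fin (n i),
        if p.1 ≠ i ∧ q.1 ≠ i then Q i p q * conc s p * conc s q else 0 := by
    refine Finset.sum_congr rfl fun p _ => Finset.sum_congr rfl fun q _ => ?_
    split_ifs with h
    · rw [conc_update_of_ne h.1, conc_update_of_ne h.2]
    · rfl
  have hlin : c i ⬝ᵥ conc (Function.update s i y) = (∑ k : Fin (n i), c i ⟨i, k⟩ * y k) +
      ∑ p : (i : I) × Fin (n i), if p.1 ≠ i then c i p * conc s p else 0 := by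
    rw [dotProduct, Fintype.sum_sigma, Fintype.sum_sigma,
      ← Finset.add_sum_erase _ _ (Finset.mem_univ i),
      ← Finset.add_sum_erase _ (fun j => ∑ k : Fin (n j),
        if (⟨j, k⟩ : (i : I) × Fin (n i)).1 ≠ i then _ else _) (Finset.mem_univ i)]
    simp only [conc, Function.update_self, ne_eq, not_true_eq_false, if_false,
      Finset.sum_const_zero, zero_add]
    congr 1
    refine Finset.sum_congr rfl fun j hj => Finset.sum_congr rfl fun k _ => ?_
    rw [if_pos (Finset.ne_of_mem_erase hj), Function.update_of_ne (Finset.ne_of_mem_erase hj)]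
  rw [Fpay, hcross, hothers, hlin]
  simp only [ownPayoff, othersPayoff, LinearMap.add_apply, LinearMap.comp_apply,
    LinearMap.sum_apply, LinearMap.smul_apply, LinearMap.proj_apply, LinearMap.fst_apply,
    LinearMap.snd_apply, LinearMap.mulLeft_apply, Matrix.traceLinearMap_apply, smul_eq_mul,
    add_mul, Finset.sum_add_distrib, mul_assoc, ← Finset.mul_sum]
  ring

lemma continuous_ownPayoff
    (Q : (i : I) → Matrix ((i : I) × Fin (n i)) ((i : I) × Fin (n i)) ℝ)
    (c : (i : I) → ((i : I) × Fin (n i)) → ℝ) (i : I)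
    (w : (Fin (n i) → ℝ) × Matrix (Fin (n i)) (Fin (n i)) ℝ) :
    Continuous fun s => ownPayoff Q c i s w := by
  simp only [ownPayoff, conc, LinearMap.add_apply, LinearMap.comp_apply, LinearMap.sum_apply,
    LinearMap.smul_apply, smul_eq_mul]
  refine continuous_const.add (continuous_finsetSum _ fun k _ => Continuous.mul ?_ continuous_const)
  refine Continuous.add (continuous_const.mul (continuous_finsetSum _ fun p _ => ?_))
    continuous_const
  split_ifs <;> fun_prop

/-- if every player's feasible set in `P_i^CPP` is nonempty, convex and
compact, then the completely positive game `G^CPP` has at least one pure-strategy Nash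
equilibrium. -/
theorem cpp_pne_exists
    (a : (i : I) → Fin (m i) → Fin (n i) → ℝ) (b : (i : I) → Fin (m i) → ℝ)
    (B : (i : I) → Set (Fin (n i))) (α : (i : I) → Fin (n i) → ℝ)
    (Q : (i : I) → Matrix ((i : I) × Fin (n i)) ((i : I) × Fin (n i)) ℝ)
    (c : (i : I) → ((i : I) × Fin (n i)) → ℝ)
    (hne : ∀ i : I, ({p : (Fin (n i) → ℝ) × Matrix (Fin (n i)) (Fin (n i)) ℝ |
      CPPFeas a b B α i p.1 p.2}).Nonempty)
    (hconv : ∀ i : I, Convex ℝ {p : (Fin (n i) → ℝ) × Matrix (Fin (n i)) (Fin (n i)) ℝ |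
      CPPFeas a b B α i p.1 p.2})
    (hcpt : ∀ i : I, IsCompact {p : (Fin (n i) → ℝ) × Matrix (Fin (n i)) (Fin (n i)) ℝ |
      CPPFeas a b B α i p.1 p.2}) :
    ∃ (s : (i : I) → Fin (n i) → ℝ)
      (XX : (i : I) → Matrix (Fin (n i)) (Fin (n i)) ℝ),
        CPP_PNE a b B α Q c s XX := by
  obtain ⟨z, hz⟩ := exists_nash_of_linear_costs hne hcpt hconv
    (L := fun i z => ownPayoff Q c i fun j => (z j).1) fun i w =>
      (continuous_ownPayoff Q c i w).comp (by fun_prop)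
  refine ⟨fun i => (z i).1, fun i => (z i).2, fun i => ⟨(hz i).1, fun y Y hY => ?_⟩⟩
  have h := Fpay_update Q c i (fun j => (z j).1) (z i).1 (z i).2
  rw [Function.update_eq_self] at h
  rw [h, Fpay_update]
  exact add_le_add_left ((hz i).2 (y, Y) hY) _
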